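/- Fix an integer n ≥ 2. For every integer k ≥ 1, no valid configuration x of the tileset τ_σ on BS(1,n) satisfies x_{a^k g} = x_g for all g ∈ BS(1,n); that is, no valid configuration is invariant under (left) translation by a^k. -/

import Mathlib

/-- The Baumslag–Solitar relation `b a^m b⁻¹ (a^n)⁻¹` in the free group on two generators. -/
def BSrel (m n : ℤ) : Set (FreeGroup (Fin 2)) :=
  {FreeGroup.of 1 * FreeGroup.of 0 ^ m * (FreeGroup.of 1)⁻¹ * (FreeGroup.of 0 ^ n)⁻¹}

/-- The Baumslag–Solitar group `BS(m,n) = ⟨a, b ∣ b a^m b⁻¹ = a^n⟩`. -/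
abbrev BS (m n : ℤ) : Type := PresentedGroup (BSrel m n)

/-- The generator `a` of `BS(m,n)`. -/
def BSa (m n : ℤ) : BS m n := PresentedGroup.of 0

/-- The generator `b` of `BS(m,n)`. -/
def BSb (m n : ℤ) : BS m n := PresentedGroup.of 1

/-- The letter at position `i` (indexed from `0`) of the length-`n` word `σ_r(c)`,
where `σ_r(0) = 0^{n-r-1} 1 0^r` and `σ_r(1) = 0^n`: it is `1` iff `c = 0` and
`i = n - 1 - r`. -/
def sigmaLetter (n r : ℕ) (c : Fin 2) (i : ℕ) : Fin 2 :=
  if c = 0 ∧ i = n - 1 - r then 1 else 0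

/-- A valid configuration of the tileset `τ_σ` on `BS(1,n)`: a map
`x : BS(1,n) → {0,1} × {0,…,n−1}`, `x g = (c_g, i_g)`, such that for every `g`:
(i) `i_{ga} = i_g`, and (ii) for every `l ∈ {1,…,n}`, `c_g = σ_{i_h}(c_h)_{l−1}` where
`h = g a^{1−l} b`. -/
def ValidConfig (n : ℕ) (x : BS 1 (n : ℤ) → Fin 2 × Fin n) : Prop :=
  ∀ g : BS 1 (n : ℤ),
    (x (g * BSa 1 (n : ℤ))).2 = (x g).2 ∧
    ∀ l : ℕ, 1 ≤ l → l ≤ n →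
      (x g).1 =
        sigmaLetter n ((x (g * BSa 1 (n : ℤ) ^ (1 - (l : ℤ)) * BSb 1 (n : ℤ))).2 : ℕ)
          ((x (g * BSa 1 (n : ℤ) ^ (1 - (l : ℤ)) * BSb 1 (n : ℤ))).1) (l - 1)

/-- The relation `b a = a^n b`, in the form `a^{nj} b = b a^j`. -/
theorem BSa_zpow_mul_BSb (n j : ℤ) :
    BSa 1 n ^ (n * j) * BSb 1 n = BSb 1 n * BSa 1 n ^ j := by
  have h : BSb 1 n * BSa 1 n ^ (1 : ℤ) * (BSb 1 n)⁻¹ * (BSa 1 n ^ n)⁻¹ = 1 :=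
    (PresentedGroup.one_of_mem (rels := BSrel 1 n) (Set.mem_singleton _) :)
  have h' : BSa 1 n ^ n = BSb 1 n * BSa 1 n * (BSb 1 n)⁻¹ := by
    rw [mul_inv_eq_one, zpow_one] at h
    exact h.symm
  rw [zpow_mul, h', conj_zpow, inv_mul_cancel_right]

namespace ValidConfig

variable {n : ℕ} {x : BS 1 (n : ℤ) → Fin 2 × Fin n}

theorem snd_mul_zpow (hx : ValidConfig n x) (g : BS 1 (n : ℤ)) (j : ℤ) :
    (x (g * BSa 1 (n : ℤ) ^ j)).2 = (x g).2 := by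
  induction j with
  | zero => simp
  | succ i ih => rw [zpow_add_one, ← mul_assoc, (hx _).1, ih]
  | pred i ih =>
    rw [← ih, ← (hx (g * BSa 1 (n : ℤ) ^ (-(i : ℤ) - 1))).1, mul_assoc, ← zpow_add_one,
      sub_add_cancel]

/-- The row through `g` is the image of the row through `g b` under the substitution `σ_r`
with `r = i_{gb}`. -/
theorem fst_mul_zpow (hx : ValidConfig n x) (g : BS 1 (n : ℤ)) (j : ℤ) {t : ℕ} (ht : t < n) :
    (x (g * BSa 1 (n : ℤ) ^ (n * j + t))).1 =
      sigmaLetter n (x (g * BSb 1 (n : ℤ))).2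
        (x (g * BSb 1 (n : ℤ) * BSa 1 (n : ℤ) ^ j)).1 t := by
  have h := (hx (g * BSa 1 (n : ℤ) ^ (n * j + t))).2 (t + 1) (by omega) ht
  have e : g * BSa 1 (n : ℤ) ^ ((n : ℤ) * j + t) * BSa 1 (n : ℤ) ^ (1 - ((t + 1 : ℕ) : ℤ)) *
      BSb 1 (n : ℤ) = g * BSb 1 (n : ℤ) * BSa 1 (n : ℤ) ^ j := by
    rw [mul_assoc g, ← zpow_add, mul_assoc g, mul_assoc g, ← BSa_zpow_mul_BSb]
    congr 3
    push_cast
    ring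
  rwa [e, hx.snd_mul_zpow, Nat.add_sub_cancel] at h

theorem fst_eq_one_iff (hx : ValidConfig n x) (g : BS 1 (n : ℤ)) (j : ℤ) {t : ℕ} (ht : t < n) :
    (x (g * BSa 1 (n : ℤ) ^ (n * j + t))).1 = 1 ↔
      (x (g * BSb 1 (n : ℤ) * BSa 1 (n : ℤ) ^ j)).1 = 0 ∧
        t = n - 1 - (x (g * BSb 1 (n : ℤ))).2 := by
  rw [hx.fst_mul_zpow g j ht, sigmaLetter]
  split_ifs with h <;> simp [h]

theorem exists_fst_eq_zero (hx : ValidConfig n x) (hn : 2 ≤ n) (g : BS 1 (n : ℤ)) :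
    ∃ j : ℤ, (x (g * BSa 1 (n : ℤ) ^ j)).1 = 0 := by
  by_contra! h
  have key (t : ℕ) (ht : t < n) : t = n - 1 - (x (g * BSb 1 (n : ℤ))).2 :=
    ((hx.fst_eq_one_iff g 0 ht).1 (Fin.eq_one_of_ne_zero _ (h _))).2
  have h0 := key 0 (by omega)
  have h1 := key 1 (by omega)
  omega

theorem exists_fst_eq_one (hx : ValidConfig n x) (hn : 2 ≤ n) (g : BS 1 (n : ℤ)) :
    ∃ j : ℤ, (x (g * BSa 1 (n : ℤ) ^ j)).1 = 1 := by
  obtain ⟨j, hj⟩ := hx.exists_fst_eq_zero hn (g * BSb 1 (n : ℤ))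
  exact ⟨_, (hx.fst_eq_one_iff g j (by omega)).2 ⟨hj, rfl⟩⟩

/-- The position modulo `n` of a letter `1` in the row through `g` is determined by `g`. -/
theorem emod_eq_of_fst_eq_one (hx : ValidConfig n x) (hn : 2 ≤ n) (g : BS 1 (n : ℤ)) {s : ℤ}
    (hs : (x (g * BSa 1 (n : ℤ) ^ s)).1 = 1) :
    s % n = (n - 1 - (x (g * BSb 1 (n : ℤ))).2 : ℕ) := by
  obtain ⟨t, ht⟩ := Int.eq_ofNat_of_zero_le (Int.emod_nonneg s (by omega : (n : ℤ) ≠ 0))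
  have hlt := Int.emod_lt_of_pos s (by omega : (0 : ℤ) < n)
  rw [← Int.mul_ediv_add_emod s n, ht, hx.fst_eq_one_iff g _ (by omega)] at hs
  rw [ht, hs.2]

/-- No row of a valid configuration has a positive period: a period `p` of the row through `g`
is a multiple of `n`, and `p / n` is a period of the row through `g b`. -/
theorem not_periodic_row (hx : ValidConfig n x) (hn : 2 ≤ n) (p : ℕ) (hp : 0 < p)
    (g : BS 1 (n : ℤ)) :
    ¬ ∀ j : ℤ, (x (g * BSa 1 (n : ℤ) ^ (j + p))).1 = (x (g * BSa 1 (n : ℤ) ^ j)).1 := by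
  induction p using Nat.strong_induction_on generalizing g with
  | _ p ih =>
    intro h
    obtain ⟨s, hs⟩ := hx.exists_fst_eq_one hn g
    have hmod : s % n = (s + p) % n := by
      rw [hx.emod_eq_of_fst_eq_one hn g hs, hx.emod_eq_of_fst_eq_one hn g ((h s).trans hs)]
    have hdvd : n ∣ p := by
      have := Int.ModEq.dvd hmod
      rw [add_sub_cancel_left] at this
      exact_mod_cast this
    obtain ⟨q, rfl⟩ := hdvd
    have hq : 0 < q := Nat.pos_of_mul_pos_left hp
    refine ih q (by nlinarith) hq (g * BSb 1 (n : ℤ)) fun j => ?_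
    have hlt : n - 1 - (x (g * BSb 1 (n : ℤ))).2 < n := by omega
    have h₁ := hx.fst_eq_one_iff g j hlt
    have h₂ := hx.fst_eq_one_iff g (j + q) hlt
    rw [← h, Nat.cast_mul, add_right_comm, ← mul_add, h₂] at h₁
    simp only [and_true] at h₁
    generalize (x (g * BSb 1 (n : ℤ) * BSa 1 (n : ℤ) ^ (j + q))).1 = u at h₁ ⊢
    generalize (x (g * BSb 1 (n : ℤ) * BSa 1 (n : ℤ) ^ j)).1 = v at h₁ ⊢
    omega

end ValidConfig

/-- No valid configuration of `τ_σ` on `BS(1,n)` is invariant under translation by `a^k`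
for any `k ≥ 1`. -/
theorem no_valid_config_ak_periodic (n : ℕ) (hn : 2 ≤ n) (k : ℕ) (hk : 1 ≤ k)
    (x : BS 1 (n : ℤ) → Fin 2 × Fin n) (hx : ValidConfig n x) :
    ¬ ∀ g : BS 1 (n : ℤ), x (BSa 1 (n : ℤ) ^ k * g) = x g := by
  intro h
  refine hx.not_periodic_row hn k hk 1 fun j => ?_
  rw [one_mul, one_mul, add_comm, zpow_add, zpow_natCast, h]
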